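/- Let d_A, d_B be positive integers, let A₁, A₂, A₃ ∈ M_{d_A}(ℂ) and B₁, B₂, B₃ ∈ M_{d_B}(ℂ) be self-adjoint unitary matrices, and let V : ℂ³ → ℂ^{d_A} ⊗ ℂ^{d_B} be an isometry; set η_i = V e_i for i = 1,2,3. Suppose that V*(A₂ ⊗ B₂)V = [[0,0,1/√2],[0,0,1/√2],[1/√2,1/√2,0]], V*(A₃ ⊗ B₃)V = [[0,0,1],[0,1,0],[1,0,0]], and V*(A₁ ⊗ I)V = V*(I ⊗ B₁)V = diag(1,−1,−1). Then, setting U₁ = A₂A₃ and U₂ = B₂B₃, the following hold: (A₃ ⊗ B₃)η₁ = η₃; ⟨(U₁ ⊗ U₂)η₁, η₂⟩ = ⟨(U₁ ⊗ U₂)η₁, η₁⟩ = 1/√2; ⟨(A₁ ⊗ I)η₁, η₁⟩ = ⟨(I ⊗ B₁)η₁, η₁⟩ = 1; and ⟨(A₁ ⊗ I)η₂, η₂⟩ = ⟨(I ⊗ B₁)η₂, η₂⟩ = −1. -/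

import Mathlib

open Matrix Kronecker

/-- Inner product on `ι → ℂ`, linear in the first argument and
conjugate-linear in the second. -/
noncomputable def ip {ι : Type*} [Fintype ι] (x y : ι → ℂ) : ℂ :=
  ∑ i, x i * (starRingEnd ℂ) (y i)

/-- `1/√2` as a complex number. -/
noncomputable def invSqrt2 : ℂ := 1 / (Real.sqrt 2 : ℂ)

theorem ip_eq_dotProduct_star {ι : Type*} [Fintype ι] (x y : ι → ℂ) : ip x y = x ⬝ᵥ star y :=
  rfl

open scoped ComplexOrder in
theorem ip_self_eq_zero {ι : Type*} [Fintype ι] {x : ι → ℂ} : ip x x = 0 ↔ x = 0 := by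
  rw [ip_eq_dotProduct_star, dotProduct_self_star_eq_zero]

theorem ip_mulVec_right {ι : Type*} [Fintype ι] (M : Matrix ι ι ℂ) (x y : ι → ℂ) :
    ip x (M *ᵥ y) = ip (Mᴴ *ᵥ x) y := by
  rw [ip_eq_dotProduct_star, ip_eq_dotProduct_star, star_mulVec, dotProduct_comm,
    ← dotProduct_mulVec, dotProduct_comm]

/-- The entries of a compression `Vᴴ M V` are inner products of columns of `V`. -/
theorem ip_mulVec_col {ι κ : Type*} [Fintype ι] (M : Matrix ι ι ℂ) (V : Matrix ι κ ℂ)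
    (i j : κ) : ip (M *ᵥ V.col i) (V.col j) = (Vᴴ * M * V) j i := by
  rw [Matrix.mul_assoc, Matrix.mul_apply, ip]
  exact Finset.sum_congr rfl fun p _ => mul_comm _ _

theorem ip_col {ι κ : Type*} [Fintype ι] (V : Matrix ι κ ℂ) (i j : κ) :
    ip (V.col i) (V.col j) = (Vᴴ * V) j i := by
  rw [Matrix.mul_apply, ip]
  exact Finset.sum_congr rfl fun p _ => mul_comm _ _

/-- The equality case of the Cauchy–Schwarz inequality for unit vectors. -/
theorem eq_of_ip_eq_one {ι : Type*} [Fintype ι] {x y : ι → ℂ} (hx : ip x x = 1)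
    (hy : ip y y = 1) (hxy : ip x y = 1) : x = y := by
  have hyx : ip y x = 1 := by
    rw [ip_eq_dotProduct_star] at hxy ⊢
    rw [← star_star y, star_dotProduct_star, hxy, star_one]
  rw [← sub_eq_zero, ← ip_self_eq_zero]
  simp only [ip_eq_dotProduct_star] at *
  rw [star_sub, sub_dotProduct, dotProduct_sub, dotProduct_sub, hx, hy, hxy, hyx]
  ring

/-- From the matrix-valued correlation data of Theorem 2.1 (equations (9)–(11)) one
recovers, with `U₁ = A₂A₃` and `U₂ = B₂B₃`, the infinite-dimensionality-witnessing
relations of Theorem 1.4. -/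
theorem stmt4 (dA dB : ℕ) (hdA : 0 < dA) (hdB : 0 < dB)
    (A₁ A₂ A₃ : Matrix (Fin dA) (Fin dA) ℂ) (B₁ B₂ B₃ : Matrix (Fin dB) (Fin dB) ℂ)
    (hA₁ : A₁ᴴ = A₁ ∧ A₁ * A₁ = 1) (hA₂ : A₂ᴴ = A₂ ∧ A₂ * A₂ = 1)
    (hA₃ : A₃ᴴ = A₃ ∧ A₃ * A₃ = 1)
    (hB₁ : B₁ᴴ = B₁ ∧ B₁ * B₁ = 1) (hB₂ : B₂ᴴ = B₂ ∧ B₂ * B₂ = 1)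
    (hB₃ : B₃ᴴ = B₃ ∧ B₃ * B₃ = 1)
    (V : Matrix (Fin dA × Fin dB) (Fin 3) ℂ) (hV : Vᴴ * V = 1)
    (η : Fin 3 → Fin dA × Fin dB → ℂ) (hη : ∀ i p, η i p = V p i)
    (h2 : Vᴴ * (A₂ ⊗ₖ B₂) * V =
      !![0, 0, invSqrt2; 0, 0, invSqrt2; invSqrt2, invSqrt2, 0])
    (h3 : Vᴴ * (A₃ ⊗ₖ B₃) * V = !![0, 0, 1; 0, 1, 0; 1, 0, 0])
    (hmargA : Vᴴ * (A₁ ⊗ₖ (1 : Matrix (Fin dB) (Fin dB) ℂ)) * V =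
      !![1, 0, 0; 0, -1, 0; 0, 0, -1])
    (hmargB : Vᴴ * ((1 : Matrix (Fin dA) (Fin dA) ℂ) ⊗ₖ B₁) * V =
      !![1, 0, 0; 0, -1, 0; 0, 0, -1]) :
    (A₃ ⊗ₖ B₃).mulVec (η 0) = η 2 ∧
    ip (((A₂ * A₃) ⊗ₖ (B₂ * B₃)).mulVec (η 0)) (η 1) = invSqrt2 ∧
    ip (((A₂ * A₃) ⊗ₖ (B₂ * B₃)).mulVec (η 0)) (η 0) = invSqrt2 ∧
    ip ((A₁ ⊗ₖ (1 : Matrix (Fin dB) (Fin dB) ℂ)).mulVec (η 0)) (η 0) = 1 ∧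
    ip (((1 : Matrix (Fin dA) (Fin dA) ℂ) ⊗ₖ B₁).mulVec (η 0)) (η 0) = 1 ∧
    ip ((A₁ ⊗ₖ (1 : Matrix (Fin dB) (Fin dB) ℂ)).mulVec (η 1)) (η 1) = -1 ∧
    ip (((1 : Matrix (Fin dA) (Fin dA) ℂ) ⊗ₖ B₁).mulVec (η 1)) (η 1) = -1 := by
  obtain rfl : η = V.col := by
    funext i p
    exact hη i p
  have hsa : (A₃ ⊗ₖ B₃)ᴴ = A₃ ⊗ₖ B₃ := by
    rw [conjTranspose_kronecker, hA₃.1, hB₃.1]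
  have hsq : (A₃ ⊗ₖ B₃) * (A₃ ⊗ₖ B₃) = 1 := by
    rw [← mul_kronecker_mul, hA₃.2, hB₃.2, one_kronecker_one]
  have hswap : (A₃ ⊗ₖ B₃) *ᵥ V.col 0 = V.col 2 := by
    apply eq_of_ip_eq_one
    · rw [ip_mulVec_right, hsa, mulVec_mulVec, hsq, one_mulVec, ip_col, hV, one_apply_eq]
    · rw [ip_col, hV, one_apply_eq]
    · rw [ip_mulVec_col, h3]
      rfl
  have hU : ((A₂ * A₃) ⊗ₖ (B₂ * B₃)) *ᵥ V.col 0 = (A₂ ⊗ₖ B₂) *ᵥ V.col 2 := by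
    rw [mul_kronecker_mul, ← mulVec_mulVec, hswap]
  rw [hU]
  simp only [ip_mulVec_col, h2, hmargA, hmargB]
  exact ⟨hswap, rfl, rfl, rfl, rfl, rfl, rfl⟩
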